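/- Let k be a field of characteristic zero whose transcendence degree over ℚ is finite. Let f be an automorphism of the field k, let α ∈ k, and let (z_i)_{i∈ℕ} be elements of k and (a_i)_{i∈ℕ} rational numbers (viewed in k via the canonical embedding ℚ ⊆ k) such that f(z_i) = α·a_i·z_i for every i, each ν(a_i) is nonempty (so in particular a_i ≠ 1), and ν(a_i) ∩ ν(a_j) = ∅ for all i ≠ j. Then the set {i ∈ ℕ : z_i ≠ 0} is finite. -/

import Mathlib

/-- For a rational number `q = a/b` in lowest terms, `nu q` is the set of primes dividing the
numerator `a` together with the primes dividing the denominator `b`. -/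
def nu (q : ℚ) : Set ℕ :=
  {p : ℕ | p.Prime ∧ ((p : ℤ) ∣ q.num ∨ p ∣ q.den)}

theorem padicValRat_ne_zero_iff_mem_nu {p : ℕ} (hp : p.Prime) {q : ℚ} (hq : q ≠ 0) :
    padicValRat p q ≠ 0 ↔ p ∈ nu q := by
  have := Fact.mk hp
  have hcop := q.reduced
  have h1 : padicValInt p q.num ≠ 0 ↔ (p : ℤ) ∣ q.num := by
    rw [Ne, padicValInt.eq_zero_iff]
    have := hp.one_lt.ne'
    have := Rat.num_ne_zero.2 hq
    tauto
  have h2 : padicValNat p q.den ≠ 0 ↔ p ∣ q.den := (dvd_iff_padicValNat_ne_zero q.den_nz).symm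
  have h3 : ¬ ((p : ℤ) ∣ q.num ∧ p ∣ q.den) := by
    rintro ⟨ha, hb⟩
    exact Nat.not_coprime_of_dvd_of_dvd hp.one_lt (Int.natCast_dvd.1 ha) hb hcop
  rw [padicValRat_def]
  simp only [nu, Set.mem_setOf_eq, hp, true_and]
  rw [← h1, ← h2] at *
  omega

theorem padicValRat_finset_prod_pow {ι : Type*} {p : ℕ} (hp : p.Prime) (s : Finset ι)
    (b : ι → ℚ) (hb : ∀ i, b i ≠ 0) (v : ι → ℕ) :
    padicValRat p (∏ i ∈ s, b i ^ v i) = ∑ i ∈ s, (v i : ℤ) * padicValRat p (b i) := by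
  classical
  have := Fact.mk hp
  induction s using Finset.induction_on with
  | empty => simp
  | insert i s hi ih =>
    rw [Finset.prod_insert hi, Finset.sum_insert hi, padicValRat.mul (pow_ne_zero _ (hb i))
      (Finset.prod_ne_zero_iff.2 fun j _ => pow_ne_zero _ (hb j)), ih, padicValRat.pow]

/-- Let `k` be a field of characteristic zero of finite transcendence degree over `ℚ` (i.e. `k`
is algebraic over a finitely generated subfield). If a field automorphism `f` of `k` acts on
elements `z i` by `f (z i) = α * a i * z i` with `a i ∈ ℚ`, each `ν (a i)` nonempty and the
`ν (a i)` pairwise disjoint, then only finitely many of the `z i` are nonzero. -/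
theorem finite_nonzero_of_field_aut_action {k : Type*} [Field k] [CharZero k]
    (htr : ∃ s : Finset k,
      Algebra.IsAlgebraic (IntermediateField.adjoin ℚ (s : Set k)) k)
    (f : k ≃+* k) (α : k) (z : ℕ → k) (a : ℕ → ℚ)
    (hfz : ∀ i : ℕ, f (z i) = α * (a i : k) * z i)
    (hne : ∀ i : ℕ, (nu (a i)).Nonempty)
    (hdisj : ∀ i j : ℕ, i ≠ j → nu (a i) ∩ nu (a j) = ∅) :
    {i : ℕ | z i ≠ 0}.Finite := by
  classical
  have ha0 : ∀ i, a i ≠ 0 := by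
    intro i hi
    obtain ⟨p, hp⟩ := hne (i + 1)
    have : p ∈ nu (a i) ∩ nu (a (i + 1)) := ⟨by simp [hi, nu, hp.1], hp⟩
    rw [hdisj i (i + 1) (by omega)] at this
    exact this
  by_contra hinf
  obtain ⟨o, ho⟩ := Set.Infinite.nonempty hinf
  have ho : z o ≠ 0 := ho
  have hα : α ≠ 0 := by
    rintro rfl
    have := hfz o
    simp [ho] at this
  have hinf' : ({i : ℕ | z i ≠ 0} \ {o}).Infinite :=
    Set.Infinite.sdiff hinf (Set.finite_singleton o)
  let ι := ↥({i : ℕ | z i ≠ 0} \ {o})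
  have : Infinite ι := hinf'.to_subtype
  let w : ι → k := fun i => z i / z o
  let b : ι → ℚ := fun i => a i / a o
  have hw0 : ∀ i, w i ≠ 0 := fun i => div_ne_zero i.2.1 ho
  have hb0 : ∀ i, b i ≠ 0 := fun i => div_ne_zero (ha0 _) (ha0 _)
  have hfw : ∀ i, f (w i) = (b i : k) * w i := by
    intro i
    have : (a o : k) ≠ 0 := by exact_mod_cast ha0 o
    simp only [w, b, map_div₀, hfz]
    push_cast
    field_simp
  let F : Module.End ℚ k := (f : k →+* k).toRatAlgHom.toLinearMap
  have hF : ∀ x, F x = f x := fun x => rfl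
  let m : (ι →₀ ℕ) → k := fun v => v.prod fun i n => w i ^ n
  let μ : (ι →₀ ℕ) → ℚ := fun v => v.prod fun i n => b i ^ n
  have hval : ∀ (j : ι) (p : ℕ), p ∈ nu (a j) → ∀ v : ι →₀ ℕ,
      padicValRat p (μ v) = v j * padicValRat p (a j) := by
    intro j p hp v
    have := Fact.mk hp.1
    have hz : ∀ i : ℕ, i ≠ j → padicValRat p (a i) = 0 := by
      intro i hij
      by_contra h
      rw [← Ne, padicValRat_ne_zero_iff_mem_nu hp.1 (ha0 i)] at h
      have : p ∈ nu (a i) ∩ nu (a j) := ⟨h, hp⟩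
      rw [hdisj i j hij] at this
      exact this
    have hbv : ∀ i : ι, padicValRat p (b i) = padicValRat p (a i) := by
      intro i
      simp only [b]
      rw [padicValRat.div (ha0 _) (ha0 _), hz o (fun h => j.2.2 h.symm), sub_zero]
    simp only [μ, Finsupp.prod]
    rw [padicValRat_finset_prod_pow hp.1 _ b hb0, Finset.sum_eq_single j]
    · rw [hbv]
    · intro i _ hij
      rw [hbv, hz i (fun h => hij (Subtype.ext h)), mul_zero]
    · intro h
      simp [Finsupp.notMem_support_iff.1 h]
  have hμ : Function.Injective μ := by
    intro u v huv
    ext j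
    obtain ⟨p, hp⟩ := hne j
    have h := hval j p hp u
    rw [huv, hval j p hp v] at h
    have := mul_right_cancel₀ ((padicValRat_ne_zero_iff_mem_nu hp.1 (ha0 j)).2 hp) h
    exact_mod_cast this.symm
  have hev : ∀ v, F.HasEigenvector (μ v) (m v) := by
    intro v
    refine ⟨Module.End.mem_eigenspace_iff.2 ?_, ?_⟩
    · rw [hF, Rat.smul_def]
      simp only [m, μ, Finsupp.prod, map_prod, map_pow, hfw, mul_pow, Finset.prod_mul_distrib]
      push_cast
      rfl
    · exact Finset.prod_ne_zero_iff.2 fun i _ => pow_ne_zero _ (hw0 i)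
  have hli : LinearIndependent ℚ m := F.eigenvectors_linearIndependent' μ hμ m hev
  have hai : AlgebraicIndependent ℚ w := by
    rw [algebraicIndependent_iff]
    intro P hP
    rw [linearIndependent_iff'] at hli
    have h := hli P.support (fun v => P.coeff v) (by
      rw [MvPolynomial.aeval_def, MvPolynomial.eval₂_eq] at hP
      rw [← hP]
      refine Finset.sum_congr rfl fun v _ => ?_
      rw [Algebra.smul_def]
      rfl)
    ext v
    by_cases hv : v ∈ P.support
    · simpa using h v hv
    · simpa using hv
  obtain ⟨s, hs⟩ := htr
  rw [IntermediateField.isAlgebraic_adjoin_iff_top] at hs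
  have h1 := hai.lift_cardinalMk_le_trdeg
  have h2 : Algebra.trdeg ℚ k ≤ Cardinal.mk (s : Set k) := Algebra.IsAlgebraic.trdeg_le_cardinalMk ℚ (s : Set k)
  have h3 : Algebra.trdeg ℚ k < Cardinal.aleph0 := h2.trans_lt (Cardinal.lt_aleph0_of_finite _)
  rw [← Cardinal.lift_lt_aleph0] at h3
  have h4 := h1.trans_lt h3
  rw [Cardinal.lift_lt_aleph0] at h4
  exact (Cardinal.aleph0_le_mk ι).not_gt h4
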